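/- arXiv:1905.09443 — 9 statements merged into one kernel-verified Lean document; each statement's English description precedes it below -/
import Mathlib

section
/- For each integer i with 0 ≤ i < pq, the set B_i = {M^i a, M^{i−1} a, M^i b, M^{i−r} b} is an orthogonal basis of ℝ⁴; that is, these four vectors are nonzero and pairwise orthogonal (with respect to the standard inner product on ℝ⁴). -/
open Matrix Real Kronecker

/-- The 2×2 rotation matrix by angle `2πs/m`. -/
noncomputable def rot (m : ℕ) (s : ℤ) : Matrix (Fin 2) (Fin 2) ℝ :=
  !![Real.cos (2 * Real.pi * s / m), -Real.sin (2 * Real.pi * s / m);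
     Real.sin (2 * Real.pi * s / m),  Real.cos (2 * Real.pi * s / m)]

/-- A vector in ℝ⁴, indexed by `Fin 2 × Fin 2` (row-major), so that
Kronecker products of 2×2 matrices act on it. -/
def vec4 (x y z w : ℝ) : Fin 2 × Fin 2 → ℝ :=
  fun i => !![x, y; z, w] i.1 i.2

/-- The rotation matrix by the angle `θ`. -/
noncomputable def rotAngle (θ : ℝ) : Matrix (Fin 2) (Fin 2) ℝ :=
  !![cos θ, -sin θ; sin θ, cos θ]

lemma rotAngle_add (s t : ℝ) : rotAngle (s + t) = rotAngle s * rotAngle t := by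
  ext i j
  fin_cases i <;> fin_cases j <;>
    simp [rotAngle, Matrix.mul_apply, Fin.sum_univ_two, cos_add, sin_add] <;> ring

lemma rotAngle_zero : rotAngle 0 = 1 := by
  simp [rotAngle, Matrix.one_fin_two]

lemma rotAngle_kronecker_pow (s t : ℝ) (n : ℕ) :
    (rotAngle s ⊗ₖ rotAngle t) ^ n = rotAngle (n * s) ⊗ₖ rotAngle (n * t) := by
  induction n with
  | zero => simp [rotAngle_zero]
  | succ k ih =>
    rw [pow_succ, ih, ← Matrix.mul_kronecker_mul, ← rotAngle_add, ← rotAngle_add]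
    push_cast
    ring_nf

lemma rotAngle_kronecker_inv (s t : ℝ) :
    (rotAngle s ⊗ₖ rotAngle t)⁻¹ = rotAngle (-s) ⊗ₖ rotAngle (-t) := by
  refine Matrix.inv_eq_right_inv ?_
  rw [← Matrix.mul_kronecker_mul, ← rotAngle_add, ← rotAngle_add]
  simp [rotAngle_zero]

lemma rotAngle_kronecker_zpow (s t : ℝ) (n : ℤ) :
    (rotAngle s ⊗ₖ rotAngle t) ^ n = rotAngle (n * s) ⊗ₖ rotAngle (n * t) := by
  obtain ⟨k, rfl | rfl⟩ := n.eq_nat_or_neg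
  · simp [rotAngle_kronecker_pow]
  · rw [Matrix.zpow_neg_natCast, rotAngle_kronecker_pow, rotAngle_kronecker_inv]
    simp

/-- The 2×2 matrix `x • R_θ + y • diag(1, -1) * R_φ`, flattened to a vector in ℝ⁴. -/
noncomputable def rotReflVec (x θ y φ : ℝ) : Fin 2 × Fin 2 → ℝ :=
  vec4 (x * cos θ + y * cos φ) (-x * sin θ - y * sin φ)
    (x * sin θ - y * sin φ) (x * cos θ - y * cos φ)

lemma rotAngle_kronecker_mulVec (s t x θ y φ : ℝ) :
    (rotAngle s ⊗ₖ rotAngle t) *ᵥ rotReflVec x θ y φ =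
      rotReflVec x (θ + (s - t)) y (φ - (s + t)) := by
  ext ⟨i, j⟩
  fin_cases i <;> fin_cases j <;>
    simp [rotAngle, rotReflVec, vec4, Matrix.mulVec, dotProduct, Fintype.sum_prod_type,
      Fin.sum_univ_two, cos_add, sin_add, cos_sub, sin_sub] <;> ring

lemma rotReflVec_dotProduct (x θ y φ x' θ' y' φ' : ℝ) :
    rotReflVec x θ y φ ⬝ᵥ rotReflVec x' θ' y' φ' =
      2 * (x * x' * cos (θ - θ') + y * y' * cos (φ - φ')) := by
  simp [rotReflVec, vec4, dotProduct, Fintype.sum_prod_type, Fin.sum_univ_two, cos_sub]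
  ring

lemma rotReflVec_ne_zero {x y : ℝ} (θ φ : ℝ) (h : x ≠ 0) : rotReflVec x θ y φ ≠ 0 := by
  intro h0
  have hd := rotReflVec_dotProduct x θ y φ x θ y φ
  rw [h0] at hd
  simp only [zero_dotProduct, sub_self, cos_zero, mul_one] at hd
  have : 0 < x * x := mul_self_pos.mpr h
  nlinarith [mul_self_nonneg y]

lemma rotReflVec_dotProduct_eq_zero {x θ y φ x' θ' y' φ' : ℝ} (s t : ℝ) (k l m n : ℤ)
    (hθ : θ - θ' = s + k * (2 * π) + l * (2 * π))
    (hφ : φ - φ' = t + m * (2 * π) + n * (2 * π))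
    (h : x * x' * cos s + y * y' * cos t = 0) :
    rotReflVec x θ y φ ⬝ᵥ rotReflVec x' θ' y' φ' = 0 := by
  rw [rotReflVec_dotProduct, hθ, hφ]
  simp only [cos_add_int_mul_two_pi]
  rw [h, mul_zero]

theorem stmt0 (p q : ℕ) (hp : 3 ≤ p) (hq : 3 ≤ q) (hpodd : Odd p) (hqodd : Odd q)
    (hpq : Nat.Coprime p q) (kp kq : ℤ)
    (hkp : Int.gcd kp p = 1) (hkq : Int.gcd kq q = 1)
    (c : ℝ) (hc : c ≠ 0)
    (hc2 : c ^ 2 = - Real.cos (2 * Real.pi * ((kp : ℝ) / p - (kq : ℝ) / q)) /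
        Real.cos (2 * Real.pi * ((kp : ℝ) / p + (kq : ℝ) / q)))
    (a b : Fin 2 × Fin 2 → ℝ)
    (ha : a = vec4 ((1 - c) * Real.cos (2 * Real.pi * kq / q))
        ((1 - c) * Real.sin (2 * Real.pi * kq / q))
        (-(1 + c) * Real.sin (2 * Real.pi * kq / q))
        ((1 + c) * Real.cos (2 * Real.pi * kq / q)))
    (hb : b = vec4 (c + 1) 0 0 (c - 1))
    (M : Matrix (Fin 2 × Fin 2) (Fin 2 × Fin 2) ℝ)
    (hM : M = rot p kp ⊗ₖ rot q kq)
    (r : ℤ) (hr0 : 0 < r) (hrpq : r < p * q)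
    (hrp : r ≡ 1 [ZMOD (p : ℤ)]) (hrq : r ≡ -1 [ZMOD (q : ℤ)])
    (i : ℤ) (hi0 : 0 ≤ i) (hipq : i < p * q) :
    -- the four vectors of `B i` are nonzero and pairwise orthogonal
    ((M ^ i) *ᵥ a ≠ 0 ∧ (M ^ (i - 1)) *ᵥ a ≠ 0 ∧
      (M ^ i) *ᵥ b ≠ 0 ∧ (M ^ (i - r)) *ᵥ b ≠ 0) ∧
    ((M ^ i) *ᵥ a) ⬝ᵥ ((M ^ (i - 1)) *ᵥ a) = 0 ∧
    ((M ^ i) *ᵥ a) ⬝ᵥ ((M ^ i) *ᵥ b) = 0 ∧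
    ((M ^ i) *ᵥ a) ⬝ᵥ ((M ^ (i - r)) *ᵥ b) = 0 ∧
    ((M ^ (i - 1)) *ᵥ a) ⬝ᵥ ((M ^ i) *ᵥ b) = 0 ∧
    ((M ^ (i - 1)) *ᵥ a) ⬝ᵥ ((M ^ (i - r)) *ᵥ b) = 0 ∧
    ((M ^ i) *ᵥ b) ⬝ᵥ ((M ^ (i - r)) *ᵥ b) = 0 := by
  set α : ℝ := 2 * π * kp / p with hα
  set β : ℝ := 2 * π * kq / q with hβ
  have hp0 : (p : ℝ) ≠ 0 := by positivity
  have hq0 : (q : ℝ) ≠ 0 := by positivity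
  have hM' : M = rotAngle α ⊗ₖ rotAngle β := hM
  have ha' : a = rotReflVec 1 (-β) (-c) (-β) := by
    rw [ha, rotReflVec, cos_neg, sin_neg]
    congr 1 <;> ring
  have hb' : b = rotReflVec c 0 1 0 := by
    rw [hb, rotReflVec]
    simp
  have hc2' : c ^ 2 = -cos (α - β) / cos (α + β) := by
    rw [hc2, hα, hβ]
    congr 3 <;> ring
  have hσ : cos (α + β) ≠ 0 := by
    intro h
    rw [h, div_zero] at hc2'
    exact hc (pow_eq_zero_iff two_ne_zero |>.mp hc2')
  have hcσ : c ^ 2 * cos (α + β) + cos (α - β) = 0 := by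
    rw [hc2', div_mul_cancel₀ _ hσ]
    ring
  obtain ⟨u, hu⟩ := hrp.symm.dvd
  obtain ⟨v, hv⟩ := hrq.symm.dvd
  have hrα : (r : ℝ) * α = α + (u * kp : ℤ) * (2 * π) := by
    have : (r : ℝ) = 1 + p * u := by exact_mod_cast (by linarith : r = 1 + p * u)
    rw [this, hα]
    push_cast
    field_simp
  have hrβ : (r : ℝ) * β = -β + (v * kq : ℤ) * (2 * π) := by
    have : (r : ℝ) = -1 + q * v := by exact_mod_cast (by linarith : r = -1 + q * v)
    rw [this, hβ]
    push_cast
    field_simp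
  simp only [hM', ha', hb', rotAngle_kronecker_zpow, rotAngle_kronecker_mulVec]
  refine ⟨⟨rotReflVec_ne_zero _ _ one_ne_zero, rotReflVec_ne_zero _ _ one_ne_zero,
    rotReflVec_ne_zero _ _ hc, rotReflVec_ne_zero _ _ hc⟩, ?_⟩
  simp only [Int.cast_sub, Int.cast_one, sub_mul, hrα, hrβ]
  generalize (u * kp : ℤ) = m
  generalize (v * kq : ℤ) = n
  refine ⟨?_, ?_, ?_, ?_, ?_, ?_⟩
  · refine rotReflVec_dotProduct_eq_zero (α - β) (-(α + β)) 0 0 0 0 (by push_cast; ring)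
      (by push_cast; ring) ?_
    rw [cos_neg]
    linear_combination hcσ
  · refine rotReflVec_dotProduct_eq_zero (-β) (-β) 0 0 0 0 (by push_cast; ring)
      (by push_cast; ring) ?_
    ring
  · refine rotReflVec_dotProduct_eq_zero α (-α) m (-n) (-m) (-n) (by push_cast; ring)
      (by push_cast; ring) ?_
    rw [cos_neg]
    ring
  · refine rotReflVec_dotProduct_eq_zero (-α) α 0 0 0 0 (by push_cast; ring)
      (by push_cast; ring) ?_
    rw [cos_neg]
    ring
  · refine rotReflVec_dotProduct_eq_zero β β m (-n) (-m) (-n) (by push_cast; ring)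
      (by push_cast; ring) ?_
    ring
  · refine rotReflVec_dotProduct_eq_zero (α + β) (-(α - β)) m (-n) (-m) (-n) (by push_cast; ring)
      (by push_cast; ring) ?_
    rw [cos_neg]
    linear_combination hcσ
end

section
/- Let V = {M^i a : 0 ≤ i < pq} ∪ {M^i b : 0 ≤ i < pq} and, for 0 ≤ i < pq, let B_i = {M^i a, M^{i−1} a, M^i b, M^{i−r} b} (indices of powers taken modulo pq). Then (V, (B_0, …, B_{pq−1})) is a Kochen–Specker pair in ℝ⁴: the number pq of bases is odd, each B_i is an orthogonal basis of ℝ⁴ contained in V, and every vector v ∈ V belongs to exactly two of the bases B_0, …, B_{pq−1} (in particular, to an even number of them). -/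
open Matrix Real Kronecker

/-- The vector of ℝ⁴ = ℝ²ˣ² given by `s` times the rotation by `φ` plus `t` times the reflection
with angle `ψ`. -/
noncomputable def rotRefl (s t φ ψ : ℝ) : Fin 2 × Fin 2 → ℝ :=
  vec4 (s * Real.cos φ + t * Real.cos ψ) (-(s * Real.sin φ) + t * Real.sin ψ)
    (s * Real.sin φ + t * Real.sin ψ) (s * Real.cos φ - t * Real.cos ψ)

theorem rotRefl_dotProduct (s t φ ψ s' t' φ' ψ' : ℝ) :
    rotRefl s t φ ψ ⬝ᵥ rotRefl s' t' φ' ψ' =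
      2 * (s * s' * Real.cos (φ - φ') + t * t' * Real.cos (ψ - ψ')) := by
  simp only [dotProduct, Fintype.sum_prod_type, Fin.sum_univ_two, rotRefl, vec4, Real.cos_sub]
  simp
  ring

theorem rotRefl_ne_zero {s t φ ψ : ℝ} (hs : s ≠ 0) : rotRefl s t φ ψ ≠ 0 := by
  intro h
  have h' := rotRefl_dotProduct s t φ ψ s t φ ψ
  rw [h] at h'
  simp only [zero_dotProduct, sub_self, Real.cos_zero, mul_one] at h'
  nlinarith [mul_self_pos.mpr hs, mul_self_nonneg t]

theorem mul_cos_eq_and_mul_sin_eq_of_rotRefl_eq {s t φ ψ s' t' φ' ψ' : ℝ}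
    (h : rotRefl s t φ ψ = rotRefl s' t' φ' ψ') :
    s * Real.cos φ = s' * Real.cos φ' ∧ s * Real.sin φ = s' * Real.sin φ' := by
  have h00 := congrFun h (0, 0)
  have h01 := congrFun h (0, 1)
  have h10 := congrFun h (1, 0)
  have h11 := congrFun h (1, 1)
  simp [rotRefl, vec4] at h00 h01 h10 h11
  constructor <;> linarith

theorem sq_eq_sq_of_rotRefl_eq {s t φ ψ s' t' φ' ψ' : ℝ}
    (h : rotRefl s t φ ψ = rotRefl s' t' φ' ψ') : s ^ 2 = s' ^ 2 := by
  obtain ⟨h1, h2⟩ := mul_cos_eq_and_mul_sin_eq_of_rotRefl_eq h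
  have e1 := congrArg (· ^ 2) h1
  have e2 := congrArg (· ^ 2) h2
  simp only [mul_pow] at e1 e2
  linear_combination e1 + e2 - s ^ 2 * Real.sin_sq_add_cos_sq φ +
    s' ^ 2 * Real.sin_sq_add_cos_sq φ'

theorem exists_int_of_rotRefl_eq {s t φ ψ t' φ' ψ' : ℝ} (hs : s ≠ 0)
    (h : rotRefl s t φ ψ = rotRefl s t' φ' ψ') : ∃ k : ℤ, φ - φ' = 2 * Real.pi * k := by
  obtain ⟨h1, h2⟩ := mul_cos_eq_and_mul_sin_eq_of_rotRefl_eq h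
  exact Real.Angle.angle_eq_iff_two_pi_dvd_sub.mp
    (Real.Angle.cos_sin_inj (mul_left_cancel₀ hs h1) (mul_left_cancel₀ hs h2))

theorem rotRefl_add_int_mul_two_pi (s t φ ψ : ℝ) (k l : ℤ) :
    rotRefl s t (φ + k * (2 * Real.pi)) (ψ + l * (2 * Real.pi)) = rotRefl s t φ ψ := by
  simp only [rotRefl, Real.cos_add_int_mul_two_pi, Real.sin_add_int_mul_two_pi]

theorem rot_kronecker_mulVec_rotRefl (p q : ℕ) (kp kq : ℤ) (s t φ ψ : ℝ) :
    (rot p kp ⊗ₖ rot q kq) *ᵥ rotRefl s t φ ψ =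
      rotRefl s t (φ + (2 * Real.pi * kp / p - 2 * Real.pi * kq / q))
        (ψ + (2 * Real.pi * kp / p + 2 * Real.pi * kq / q)) := by
  funext ⟨i, j⟩
  fin_cases i <;> fin_cases j <;>
    simp [mulVec, dotProduct, Fintype.sum_prod_type, Fin.sum_univ_two, rotRefl, vec4, rot,
      Real.cos_add, Real.cos_sub, Real.sin_add, Real.sin_sub] <;> ring

theorem isUnit_det_rot_kronecker (p q : ℕ) (kp kq : ℤ) :
    IsUnit (rot p kp ⊗ₖ rot q kq).det := by
  have h (m : ℕ) (s : ℤ) : (rot m s).det = 1 := by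
    rw [rot, det_fin_two_of]
    linear_combination Real.sin_sq_add_cos_sq (2 * Real.pi * s / m)
  simp [det_kronecker, h]

theorem rot_kronecker_zpow_mulVec_rotRefl (p q : ℕ) (kp kq : ℤ) (s t φ ψ : ℝ) (n : ℤ) :
    ((rot p kp ⊗ₖ rot q kq) ^ n) *ᵥ rotRefl s t φ ψ =
      rotRefl s t (φ + n * (2 * Real.pi * kp / p - 2 * Real.pi * kq / q))
        (ψ + n * (2 * Real.pi * kp / p + 2 * Real.pi * kq / q)) := by
  have hu := isUnit_det_rot_kronecker p q kp kq
  induction n using Int.induction_on generalizing φ ψ with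
  | zero => simp
  | succ n ih =>
    rw [zpow_add_one hu, ← mulVec_mulVec, rot_kronecker_mulVec_rotRefl, ih]
    congr 1 <;> push_cast <;> ring
  | pred n ih =>
    have hinv : (rot p kp ⊗ₖ rot q kq)⁻¹ *ᵥ rotRefl s t φ ψ =
        rotRefl s t (φ - (2 * Real.pi * kp / p - 2 * Real.pi * kq / q))
          (ψ - (2 * Real.pi * kp / p + 2 * Real.pi * kq / q)) := by
      have h := rot_kronecker_mulVec_rotRefl p q kp kq s t
        (φ - (2 * Real.pi * kp / p - 2 * Real.pi * kq / q))
        (ψ - (2 * Real.pi * kp / p + 2 * Real.pi * kq / q))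
      rw [sub_add_cancel, sub_add_cancel] at h
      rw [← h, mulVec_mulVec, nonsing_inv_mul _ hu, one_mulVec]
    rw [zpow_sub_one hu, ← mulVec_mulVec, hinv, ih]
    congr 1 <;> push_cast <;> ring

theorem rot_kronecker_zpow_mulVec_rotRefl_eq_iff {p q : ℕ} (hp : p ≠ 0) (hq : q ≠ 0)
    (hpq : p.Coprime q) {kp kq : ℤ} (hkp : Int.gcd kp p = 1) (hkq : Int.gcd kq q = 1)
    {s : ℝ} (hs : s ≠ 0) (t φ ψ : ℝ) (m n : ℤ) :
    ((rot p kp ⊗ₖ rot q kq) ^ m) *ᵥ rotRefl s t φ ψ =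
      ((rot p kp ⊗ₖ rot q kq) ^ n) *ᵥ rotRefl s t φ ψ ↔ m ≡ n [ZMOD (p * q : ℤ)] := by
  have hp' : (p : ℝ) ≠ 0 := by exact_mod_cast hp
  have hq' : (q : ℝ) ≠ 0 := by exact_mod_cast hq
  have hpqZ : IsCoprime (p : ℤ) q := Nat.isCoprime_iff_coprime.mpr hpq
  simp only [rot_kronecker_zpow_mulVec_rotRefl]
  rw [Int.modEq_comm, Int.modEq_iff_dvd]
  constructor
  · intro h
    obtain ⟨k, hk⟩ := exists_int_of_rotRefl_eq hs h
    have hreal : ((m : ℝ) - n) * (kp * q - kq * p) = k * (p * q) := by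
      field_simp at hk
      have : (2 * Real.pi) * (((m : ℝ) - n) * (kp * q - kq * p)) =
          (2 * Real.pi) * (k * (p * q)) := by linear_combination hk
      exact mul_left_cancel₀ (by positivity) this
    have hint : (m - n) * (kp * q - kq * p) = k * (p * q) := by exact_mod_cast hreal
    refine hpqZ.mul_dvd ?_ ?_
    · have h1 : (p : ℤ) ∣ (m - n) * (kp * q) :=
        ⟨k * q + (m - n) * kq, by linear_combination hint⟩
      exact ((Int.isCoprime_iff_gcd_eq_one.mpr hkp).symm.mul_right hpqZ).dvd_of_dvd_mul_right h1
    · have h1 : (q : ℤ) ∣ (m - n) * (kq * p) :=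
        ⟨(m - n) * kp - k * p, by linear_combination -hint⟩
      exact ((Int.isCoprime_iff_gcd_eq_one.mpr hkq).symm.mul_right
        hpqZ.symm).dvd_of_dvd_mul_right h1
  · rintro ⟨k, hk⟩
    have hm : (m : ℝ) = n + p * q * k := by exact_mod_cast eq_add_of_sub_eq' hk
    rw [← rotRefl_add_int_mul_two_pi s t (φ + n * _) _ (k * (kp * q - kq * p))
      (k * (kp * q + kq * p)), hm]
    congr 1 <;> push_cast <;> field_simp <;> ring

theorem cos_two_pi_mul_div_ne_zero {p : ℕ} (hp : Odd p) (k : ℤ) :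
    Real.cos (2 * Real.pi * k / p) ≠ 0 := by
  intro h
  obtain ⟨n, hn⟩ := Real.cos_eq_zero_iff.mp h
  have hp' : (p : ℝ) ≠ 0 := by exact_mod_cast hp.pos.ne'
  field_simp at hn
  have h1 : (4 : ℤ) * k = (2 * n + 1) * p := by
    have : (4 : ℝ) * k = (2 * n + 1) * p := by linear_combination hn
    exact_mod_cast this
  have h2 : Odd ((2 * n + 1) * (p : ℤ)) := (odd_two_mul_add_one n).mul (by exact_mod_cast hp)
  rw [← h1] at h2
  exact (Int.not_odd_iff_even.mpr ⟨2 * k, by ring⟩) h2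

theorem ncard_modEq_or_modEq_sub {N d : ℤ} (hd : 0 < d) (hdN : d < N) (j : ℤ) :
    {i : ℤ | 0 ≤ i ∧ i < N ∧ (j ≡ i [ZMOD N] ∨ j ≡ i - d [ZMOD N])}.ncard = 2 := by
  have hN : 0 < N := hd.trans hdN
  have key (x i : ℤ) : 0 ≤ i ∧ i < N ∧ x ≡ i [ZMOD N] ↔ i = x % N := by
    constructor
    · rintro ⟨h0, h1, h2⟩
      rw [h2, Int.emod_eq_of_lt h0 h1]
    · rintro rfl
      exact ⟨Int.emod_nonneg _ hN.ne', Int.emod_lt_of_pos _ hN, (Int.mod_modEq _ _).symm⟩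
  have hsub (i : ℤ) : j ≡ i - d [ZMOD N] ↔ j + d ≡ i [ZMOD N] := by
    simp only [Int.modEq_iff_dvd, sub_sub, add_comm]
  have hset : {i : ℤ | 0 ≤ i ∧ i < N ∧ (j ≡ i [ZMOD N] ∨ j ≡ i - d [ZMOD N])} =
      {j % N, (j + d) % N} := by
    ext i
    rw [Set.mem_insert_iff, Set.mem_singleton_iff, ← key, ← key, Set.mem_ofPred_eq, hsub]
    tauto
  rw [hset, Set.ncard_pair]
  intro h
  have hdvd : N ∣ j + d - j := Int.modEq_iff_dvd.mp h
  rw [add_sub_cancel_left] at hdvd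
  exact absurd (Int.le_of_dvd hd hdvd) (by lia)

theorem stmt1 (p q : ℕ) (hp : 3 ≤ p) (hq : 3 ≤ q) (hpodd : Odd p) (hqodd : Odd q)
    (hpq : Nat.Coprime p q) (kp kq : ℤ)
    (hkp : Int.gcd kp p = 1) (hkq : Int.gcd kq q = 1)
    (c : ℝ) (hc : c ≠ 0)
    (hc2 : c ^ 2 = - Real.cos (2 * Real.pi * ((kp : ℝ) / p - (kq : ℝ) / q)) /
        Real.cos (2 * Real.pi * ((kp : ℝ) / p + (kq : ℝ) / q)))
    (a b : Fin 2 × Fin 2 → ℝ)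
    (ha : a = vec4 ((1 - c) * Real.cos (2 * Real.pi * kq / q))
        ((1 - c) * Real.sin (2 * Real.pi * kq / q))
        (-(1 + c) * Real.sin (2 * Real.pi * kq / q))
        ((1 + c) * Real.cos (2 * Real.pi * kq / q)))
    (hb : b = vec4 (c + 1) 0 0 (c - 1))
    (M : Matrix (Fin 2 × Fin 2) (Fin 2 × Fin 2) ℝ)
    (hM : M = rot p kp ⊗ₖ rot q kq)
    (r : ℤ) (hr0 : 0 < r) (hrpq : r < p * q)
    (hrp : r ≡ 1 [ZMOD (p : ℤ)]) (hrq : r ≡ -1 [ZMOD (q : ℤ)])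
    (V : Set (Fin 2 × Fin 2 → ℝ))
    (hV : V = {v | ∃ i : ℤ, 0 ≤ i ∧ i < p * q ∧ (v = (M ^ i) *ᵥ a ∨ v = (M ^ i) *ᵥ b)})
    (B : ℤ → Set (Fin 2 × Fin 2 → ℝ))
    (hB : B = fun i =>
      {(M ^ i) *ᵥ a, (M ^ (i - 1)) *ᵥ a, (M ^ i) *ᵥ b, (M ^ (i - r)) *ᵥ b}) :
    -- the number of bases is odd
    Odd (p * q) ∧
    -- each `B i` is an orthogonal basis of ℝ⁴ contained in `V`
    (∀ i : ℤ, 0 ≤ i → i < p * q →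
      B i ⊆ V ∧
      ((M ^ i) *ᵥ a ≠ 0 ∧ (M ^ (i - 1)) *ᵥ a ≠ 0 ∧
        (M ^ i) *ᵥ b ≠ 0 ∧ (M ^ (i - r)) *ᵥ b ≠ 0) ∧
      ((M ^ i) *ᵥ a) ⬝ᵥ ((M ^ (i - 1)) *ᵥ a) = 0 ∧
      ((M ^ i) *ᵥ a) ⬝ᵥ ((M ^ i) *ᵥ b) = 0 ∧
      ((M ^ i) *ᵥ a) ⬝ᵥ ((M ^ (i - r)) *ᵥ b) = 0 ∧
      ((M ^ (i - 1)) *ᵥ a) ⬝ᵥ ((M ^ i) *ᵥ b) = 0 ∧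
      ((M ^ (i - 1)) *ᵥ a) ⬝ᵥ ((M ^ (i - r)) *ᵥ b) = 0 ∧
      ((M ^ i) *ᵥ b) ⬝ᵥ ((M ^ (i - r)) *ᵥ b) = 0) ∧
    -- every vector of `V` lies in exactly two of the bases `B 0, …, B (pq-1)`
    (∀ v ∈ V, {i : ℤ | 0 ≤ i ∧ i < p * q ∧ v ∈ B i}.ncard = 2) := by
  set α : ℝ := 2 * Real.pi * kp / p with hα
  set β : ℝ := 2 * Real.pi * kq / q with hβ
  have hp0 : p ≠ 0 := by lia
  have hq0 : q ≠ 0 := by lia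
  have hpR : (p : ℝ) ≠ 0 := by exact_mod_cast hp0
  have hqR : (q : ℝ) ≠ 0 := by exact_mod_cast hq0
  rw [show 2 * Real.pi * ((kp : ℝ) / p - (kq : ℝ) / q) = α - β by rw [hα, hβ]; ring,
    show 2 * Real.pi * ((kp : ℝ) / p + (kq : ℝ) / q) = α + β by rw [hα, hβ]; ring] at hc2
  have hcos : Real.cos (α + β) ≠ 0 := by
    intro h
    rw [h, div_zero] at hc2
    exact hc (pow_eq_zero_iff two_ne_zero |>.mp hc2)
  have hcc : Real.cos (α - β) + c ^ 2 * Real.cos (α + β) = 0 := by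
    rw [hc2, div_mul_cancel₀ _ hcos, add_neg_cancel]
  have hc1 : c ^ 2 ≠ 1 := by
    intro h
    rw [h, Real.cos_add, Real.cos_sub] at hcc
    have : Real.cos α * Real.cos β = 0 := by linarith
    exact (mul_ne_zero (cos_two_pi_mul_div_ne_zero hpodd kp)
      (cos_two_pi_mul_div_ne_zero hqodd kq)) this
  obtain ⟨k, hk⟩ : ∃ k : ℤ, r * α = α + k * (2 * Real.pi) := by
    obtain ⟨l, hl⟩ := Int.modEq_iff_dvd.mp hrp.symm
    have hl' : (r : ℝ) = 1 + p * l := by exact_mod_cast eq_add_of_sub_eq' hl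
    refine ⟨kp * l, ?_⟩
    rw [hl', hα]
    push_cast
    field_simp
  obtain ⟨l, hl⟩ : ∃ l : ℤ, r * β = -β + l * (2 * Real.pi) := by
    obtain ⟨l, hl⟩ := Int.modEq_iff_dvd.mp hrq.symm
    have hl' : (r : ℝ) = -1 + q * l := by exact_mod_cast eq_add_of_sub_eq' hl
    refine ⟨kq * l, ?_⟩
    rw [hl', hβ]
    push_cast
    field_simp
  have ha' : a = rotRefl 1 (-c) (-β) β := by
    rw [ha, rotRefl, Real.cos_neg, Real.sin_neg]
    congr 1 <;> ring
  have hb' : b = rotRefl c 1 0 0 := by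
    rw [hb, rotRefl, Real.cos_zero, Real.sin_zero]
    congr 1 <;> ring
  have hMa (i : ℤ) : (M ^ i) *ᵥ a = rotRefl 1 (-c) (-β + i * (α - β)) (β + i * (α + β)) := by
    rw [hM, ha', rot_kronecker_zpow_mulVec_rotRefl]
  have hMb (i : ℤ) : (M ^ i) *ᵥ b = rotRefl c 1 (0 + i * (α - β)) (0 + i * (α + β)) := by
    rw [hM, hb', rot_kronecker_zpow_mulVec_rotRefl]
  have haa (i j : ℤ) : (M ^ i) *ᵥ a = (M ^ j) *ᵥ a ↔ i ≡ j [ZMOD (p * q : ℤ)] := by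
    rw [hM, ha']
    exact rot_kronecker_zpow_mulVec_rotRefl_eq_iff hp0 hq0 hpq hkp hkq one_ne_zero _ _ _ _ _
  have hbb (i j : ℤ) : (M ^ i) *ᵥ b = (M ^ j) *ᵥ b ↔ i ≡ j [ZMOD (p * q : ℤ)] := by
    rw [hM, hb']
    exact rot_kronecker_zpow_mulVec_rotRefl_eq_iff hp0 hq0 hpq hkp hkq hc _ _ _ _ _
  have hab (i j : ℤ) : (M ^ i) *ᵥ a ≠ (M ^ j) *ᵥ b := by
    rw [hMa, hMb]
    intro h
    have := sq_eq_sq_of_rotRefl_eq h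
    exact hc1 (by linarith)
  have hN : (0 : ℤ) < p * q := hr0.trans hrpq
  have hmemV (i : ℤ) : (M ^ i) *ᵥ a ∈ V ∧ (M ^ i) *ᵥ b ∈ V := by
    have h0 := Int.emod_nonneg i hN.ne'
    have h1 := Int.emod_lt_of_pos i hN
    have h2 : i ≡ i % (p * q : ℤ) [ZMOD (p * q : ℤ)] := (Int.mod_modEq _ _).symm
    rw [hV]
    exact ⟨⟨_, h0, h1, Or.inl ((haa _ _).mpr h2)⟩, ⟨_, h0, h1, Or.inr ((hbb _ _).mpr h2)⟩⟩
  refine ⟨hpodd.mul hqodd, fun i _ _ => ⟨?_, ⟨?_, ?_, ?_, ?_⟩, ?_, ?_, ?_, ?_, ?_, ?_⟩, ?_⟩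
  · rw [hB]
    rintro v (rfl | rfl | rfl | rfl)
    exacts [(hmemV _).1, (hmemV _).1, (hmemV _).2, (hmemV _).2]
  · exact hMa i ▸ rotRefl_ne_zero one_ne_zero
  · exact hMa (i - 1) ▸ rotRefl_ne_zero one_ne_zero
  · exact hMb i ▸ rotRefl_ne_zero hc
  · exact hMb (i - r) ▸ rotRefl_ne_zero hc
  · rw [hMa, hMa, rotRefl_dotProduct]
    push_cast
    ring_nf at hcc ⊢
    linear_combination 2 * hcc
  · rw [hMa, hMb, rotRefl_dotProduct]
    ring_nf
    rw [Real.cos_neg]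
    ring
  · rw [hMa, hMb, rotRefl_dotProduct]
    rw [show -β + i * (α - β) - (0 + ((i - r : ℤ) : ℝ) * (α - β)) =
        α + (k - l : ℤ) * (2 * Real.pi) by push_cast; linear_combination hk - hl,
      show β + i * (α + β) - (0 + ((i - r : ℤ) : ℝ) * (α + β)) =
        α + (k + l : ℤ) * (2 * Real.pi) by push_cast; linear_combination hk + hl,
      Real.cos_add_int_mul_two_pi, Real.cos_add_int_mul_two_pi]
    ring
  · rw [hMa, hMb, rotRefl_dotProduct]
    push_cast
    ring_nf
  · rw [hMa, hMb, rotRefl_dotProduct]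
    rw [show -β + ((i - 1 : ℤ) : ℝ) * (α - β) - (0 + ((i - r : ℤ) : ℝ) * (α - β)) =
        β + (k - l : ℤ) * (2 * Real.pi) by push_cast; linear_combination hk - hl,
      show β + ((i - 1 : ℤ) : ℝ) * (α + β) - (0 + ((i - r : ℤ) : ℝ) * (α + β)) =
        -β + (k + l : ℤ) * (2 * Real.pi) by push_cast; linear_combination hk + hl,
      Real.cos_add_int_mul_two_pi, Real.cos_add_int_mul_two_pi, Real.cos_neg]
    ring
  · rw [hMb, hMb, rotRefl_dotProduct]
    rw [show 0 + i * (α - β) - (0 + ((i - r : ℤ) : ℝ) * (α - β)) =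
        α + β + (k - l : ℤ) * (2 * Real.pi) by push_cast; linear_combination hk - hl,
      show 0 + i * (α + β) - (0 + ((i - r : ℤ) : ℝ) * (α + β)) =
        α - β + (k + l : ℤ) * (2 * Real.pi) by push_cast; linear_combination hk + hl,
      Real.cos_add_int_mul_two_pi, Real.cos_add_int_mul_two_pi]
    linear_combination 2 * hcc
  · rw [hV, hB]
    rintro v ⟨j, -, -, rfl | rfl⟩
    · simp only [Set.mem_insert_iff, Set.mem_singleton_iff, haa, hab, or_false]
      exact ncard_modEq_or_modEq_sub one_pos (by lia) j
    · simp only [Set.mem_insert_iff, Set.mem_singleton_iff, hbb, (hab _ _).symm, false_or]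
      exact ncard_modEq_or_modEq_sub hr0 hrpq j
end

section
/- Let m and n be integers with m = 0 or n = 1. Then aᵀ (R_{p,k_p}^m ⊗ R_{q,k_q}^n) b = 0, where ⊗ denotes the Kronecker product. -/
open Matrix Real Kronecker

/-- Integer powers of a rotation matrix keep the form `!![x, -y; y, x]`, since they commute with
the quarter turn. -/
lemma exists_rot_zpow_eq (m : ℕ) (s k : ℤ) : ∃ x y : ℝ, rot m s ^ k = !![x, -y; y, x] := by
  have hJ : Commute (!![0, -1; 1, 0] : Matrix (Fin 2) (Fin 2) ℝ) (rot m s) := by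
    ext i j
    fin_cases i <;> fin_cases j <;> simp [rot, Matrix.mul_apply, Fin.sum_univ_two]
  have h := (Matrix.Commute.zpow_right hJ k).eq
  have h₀ := congrFun₂ h 0 0
  have h₁ := congrFun₂ h 0 1
  simp only [Matrix.mul_apply, Fin.sum_univ_two, Matrix.of_apply, Matrix.cons_val',
    Matrix.cons_val_zero, Matrix.cons_val_one, Matrix.cons_val_fin_one] at h₀ h₁
  refine ⟨(rot m s ^ k) 0 0, (rot m s ^ k) 1 0, ?_⟩
  ext i j
  fin_cases i <;> fin_cases j <;> simp <;> linarith

theorem stmt2 (p q : ℕ) (hp : 3 ≤ p) (hq : 3 ≤ q) (hpodd : Odd p) (hqodd : Odd q)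
    (hpq : Nat.Coprime p q) (kp kq : ℤ)
    (hkp : Int.gcd kp p = 1) (hkq : Int.gcd kq q = 1)
    (c : ℝ) (hc : c ≠ 0)
    (hc2 : c ^ 2 = - Real.cos (2 * Real.pi * ((kp : ℝ) / p - (kq : ℝ) / q)) /
        Real.cos (2 * Real.pi * ((kp : ℝ) / p + (kq : ℝ) / q)))
    (a b : Fin 2 × Fin 2 → ℝ)
    (ha : a = vec4 ((1 - c) * Real.cos (2 * Real.pi * kq / q))
        ((1 - c) * Real.sin (2 * Real.pi * kq / q))
        (-(1 + c) * Real.sin (2 * Real.pi * kq / q))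
        ((1 + c) * Real.cos (2 * Real.pi * kq / q)))
    (hb : b = vec4 (c + 1) 0 0 (c - 1))
    (m n : ℤ) (hmn : m = 0 ∨ n = 1) :
    a ⬝ᵥ (((rot p kp ^ m) ⊗ₖ (rot q kq ^ n)) *ᵥ b) = 0 := by
  subst ha hb
  rcases hmn with rfl | rfl
  · obtain ⟨x, y, h⟩ := exists_rot_zpow_eq q kq n
    simp [h, vec4, dotProduct, Matrix.mulVec, Fintype.sum_prod_type, Fin.sum_univ_two]
    ring
  · obtain ⟨x, y, h⟩ := exists_rot_zpow_eq p kp m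
    rw [h]
    simp [rot, vec4, dotProduct, Matrix.mulVec, Fintype.sum_prod_type, Fin.sum_univ_two]
    ring
end

section
/- The set B_0 = {a, M^{−1} a, b, M^{−r} b} is an orthogonal basis of ℝ⁴; that is, these four vectors are nonzero and pairwise orthogonal with respect to the standard inner product on ℝ⁴. -/
open Matrix Real Kronecker

theorem rot_zero (m : ℕ) : rot m 0 = 1 := by
  simp [rot, Matrix.one_fin_two]

theorem rot_add (m : ℕ) (s t : ℤ) : rot m (s + t) = rot m s * rot m t := by
  have h : 2 * Real.pi * ((s + t : ℤ) : ℝ) / m =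
      2 * Real.pi * s / m + 2 * Real.pi * t / m := by
    push_cast; ring
  rw [rot, h, Real.cos_add, Real.sin_add, rot, rot, Matrix.mul_fin_two]
  congr 1
  ext i j
  fin_cases i <;> fin_cases j <;> simp <;> ring

theorem rot_eq_of_modEq {m : ℕ} (hm : m ≠ 0) {s t : ℤ} (h : s ≡ t [ZMOD (m : ℤ)]) :
    rot m s = rot m t := by
  obtain ⟨k, hk⟩ := h.symm.dvd
  obtain rfl : s = t + m * k := by linarith
  have hm' : (m : ℝ) ≠ 0 := Nat.cast_ne_zero.mpr hm
  have e : 2 * Real.pi * ((t + m * k : ℤ) : ℝ) / m =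
      2 * Real.pi * t / m + k * (2 * Real.pi) := by
    push_cast; field_simp
  rw [rot, e, Real.cos_add_int_mul_two_pi, Real.sin_add_int_mul_two_pi, rot]

theorem rot_kronecker_rot_zpow (p q : ℕ) (s t n : ℤ) :
    (rot p s ⊗ₖ rot q t) ^ n = rot p (n * s) ⊗ₖ rot q (n * t) := by
  have hpow : ∀ k : ℕ, (rot p s ⊗ₖ rot q t) ^ k = rot p (k * s) ⊗ₖ rot q (k * t) := by
    intro k
    induction k with
    | zero => simp [rot_zero]
    | succ k ih =>
      rw [pow_succ, ih, ← Matrix.mul_kronecker_mul, ← rot_add, ← rot_add]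
      congr 2 <;> push_cast <;> ring
  obtain ⟨k, rfl | rfl⟩ := n.eq_nat_or_neg
  · rw [zpow_natCast, hpow]
  · rw [Matrix.zpow_neg_natCast, hpow]
    refine Matrix.inv_eq_right_inv ?_
    rw [← Matrix.mul_kronecker_mul, ← rot_add, ← rot_add]
    simp [rot_zero]

theorem rot_kronecker_rot_mulVec_ne_zero (p q : ℕ) (s t : ℤ) {v : Fin 2 × Fin 2 → ℝ}
    (hv : v ≠ 0) : (rot p s ⊗ₖ rot q t) *ᵥ v ≠ 0 := by
  intro h
  apply hv
  have h' := congrArg ((rot p (-s) ⊗ₖ rot q (-t)) *ᵥ ·) h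
  simpa [Matrix.mulVec_mulVec, ← Matrix.mul_kronecker_mul, ← rot_add, rot_zero] using h'

theorem stmt3 (p q : ℕ) (hp : 3 ≤ p) (hq : 3 ≤ q) (hpodd : Odd p) (hqodd : Odd q)
    (hpq : Nat.Coprime p q) (kp kq : ℤ)
    (hkp : Int.gcd kp p = 1) (hkq : Int.gcd kq q = 1)
    (c : ℝ) (hc : c ≠ 0)
    (hc2 : c ^ 2 = - Real.cos (2 * Real.pi * ((kp : ℝ) / p - (kq : ℝ) / q)) /
        Real.cos (2 * Real.pi * ((kp : ℝ) / p + (kq : ℝ) / q)))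
    (a b : Fin 2 × Fin 2 → ℝ)
    (ha : a = vec4 ((1 - c) * Real.cos (2 * Real.pi * kq / q))
        ((1 - c) * Real.sin (2 * Real.pi * kq / q))
        (-(1 + c) * Real.sin (2 * Real.pi * kq / q))
        ((1 + c) * Real.cos (2 * Real.pi * kq / q)))
    (hb : b = vec4 (c + 1) 0 0 (c - 1))
    (M : Matrix (Fin 2 × Fin 2) (Fin 2 × Fin 2) ℝ)
    (hM : M = rot p kp ⊗ₖ rot q kq)
    (r : ℤ) (hr0 : 0 < r) (hrpq : r < p * q)
    (hrp : r ≡ 1 [ZMOD (p : ℤ)]) (hrq : r ≡ -1 [ZMOD (q : ℤ)]) :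
    -- the four vectors of `B 0 = {a, M⁻¹a, b, M⁻ʳb}` are nonzero and pairwise orthogonal
    (a ≠ 0 ∧ (M ^ (-1 : ℤ)) *ᵥ a ≠ 0 ∧ b ≠ 0 ∧ (M ^ (-r)) *ᵥ b ≠ 0) ∧
    a ⬝ᵥ ((M ^ (-1 : ℤ)) *ᵥ a) = 0 ∧
    a ⬝ᵥ b = 0 ∧
    a ⬝ᵥ ((M ^ (-r)) *ᵥ b) = 0 ∧
    ((M ^ (-1 : ℤ)) *ᵥ a) ⬝ᵥ b = 0 ∧
    ((M ^ (-1 : ℤ)) *ᵥ a) ⬝ᵥ ((M ^ (-r)) *ᵥ b) = 0 ∧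
    b ⬝ᵥ ((M ^ (-r)) *ᵥ b) = 0 := by
  subst ha hb hM
  have hp0 : p ≠ 0 := by omega
  have hq0 : q ≠ 0 := by omega
  have hMr : (rot p kp ⊗ₖ rot q kq) ^ (-r) = rot p (-kp) ⊗ₖ rot q kq := by
    rw [rot_kronecker_rot_zpow,
      rot_eq_of_modEq hp0 (show -r * kp ≡ -kp [ZMOD (p : ℤ)] by
        simpa using hrp.neg.mul_right kp),
      rot_eq_of_modEq hq0 (show -r * kq ≡ kq [ZMOD (q : ℤ)] by
        simpa using hrq.neg.mul_right kq)]
  have hM1 : (rot p kp ⊗ₖ rot q kq) ^ (-1 : ℤ) = rot p (-kp) ⊗ₖ rot q (-kq) := by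
    rw [rot_kronecker_rot_zpow, neg_one_mul, neg_one_mul]
  rw [hMr, hM1]
  have hrel : c ^ 2 * Real.cos (2 * Real.pi * kp / p + 2 * Real.pi * kq / q) =
      -Real.cos (2 * Real.pi * kp / p - 2 * Real.pi * kq / q) := by
    have hadd : 2 * Real.pi * ((kp : ℝ) / p + (kq : ℝ) / q) =
      2 * Real.pi * kp / p + 2 * Real.pi * kq / q := by ring
    have hsub : 2 * Real.pi * ((kp : ℝ) / p - (kq : ℝ) / q) =
      2 * Real.pi * kp / p - 2 * Real.pi * kq / q := by ring
    rw [hadd, hsub] at hc2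
    have hne : Real.cos (2 * Real.pi * kp / p + 2 * Real.pi * kq / q) ≠ 0 := by
      intro h0
      rw [h0, div_zero] at hc2
      exact hc (pow_eq_zero_iff two_ne_zero |>.mp hc2)
    rw [hc2, div_mul_cancel₀ _ hne]
  have hnegp : rot p (-kp) = !![Real.cos (2 * Real.pi * kp / p), Real.sin (2 * Real.pi * kp / p);
      -Real.sin (2 * Real.pi * kp / p), Real.cos (2 * Real.pi * kp / p)] := by
    simp [rot, neg_div]
  have hnegq : rot q (-kq) = !![Real.cos (2 * Real.pi * kq / q), Real.sin (2 * Real.pi * kq / q);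
      -Real.sin (2 * Real.pi * kq / q), Real.cos (2 * Real.pi * kq / q)] := by
    simp [rot, neg_div]
  have hsc := Real.sin_sq_add_cos_sq (2 * Real.pi * kq / q)
  have hane : vec4 ((1 - c) * Real.cos (2 * Real.pi * kq / q))
        ((1 - c) * Real.sin (2 * Real.pi * kq / q))
        (-(1 + c) * Real.sin (2 * Real.pi * kq / q))
        ((1 + c) * Real.cos (2 * Real.pi * kq / q)) ≠ 0 := by
    intro h
    have h1 := congrFun h (0, 0)
    have h2 := congrFun h (0, 1)
    have h3 := congrFun h (1, 0)
    have h4 := congrFun h (1, 1)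
    simp only [vec4, Matrix.of_apply, Matrix.cons_val', Matrix.cons_val_zero, Matrix.cons_val_one,
      Pi.zero_apply, Matrix.cons_val_fin_one] at h1 h2 h3 h4
    generalize Real.cos (2 * Real.pi * kq / q) = x at *
    generalize Real.sin (2 * Real.pi * kq / q) = y at *
    have hx : 2 * x = 0 := by linear_combination h1 + h4
    have hy : 2 * y = 0 := by linear_combination h2 - h3
    nlinarith
  have hbne : vec4 (c + 1) 0 0 (c - 1) ≠ 0 := by
    intro h
    have h1 := congrFun h (0, 0)
    have h4 := congrFun h (1, 1)
    simp [vec4] at h1 h4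
    linarith
  refine ⟨⟨hane, rot_kronecker_rot_mulVec_ne_zero _ _ _ _ hane, hbne,
    rot_kronecker_rot_mulVec_ne_zero _ _ _ _ hbne⟩, ?_⟩
  rw [Real.cos_add, Real.cos_sub] at hrel
  rw [hnegp, hnegq, rot]
  simp only [dotProduct, Matrix.mulVec, Fintype.sum_prod_type, Fin.sum_univ_two,
    Matrix.kroneckerMap_apply, vec4, Matrix.of_apply, Matrix.cons_val', Matrix.cons_val_zero,
    Matrix.cons_val_one, Matrix.cons_val_fin_one]
  generalize Real.cos (2 * Real.pi * kq / q) = x at *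
  generalize Real.sin (2 * Real.pi * kq / q) = y at *
  generalize Real.cos (2 * Real.pi * kp / p) = u at *
  generalize Real.sin (2 * Real.pi * kp / p) = v at *
  refine ⟨?_, ?_, ?_, ?_, ?_, ?_⟩
  · linear_combination 2 * (x ^ 2 + y ^ 2) * hrel
  · ring
  · ring
  · ring
  · ring
  · linear_combination 2 * hrel
end

section
/- The vector a is orthogonal to (R_{p,k_p}^{−1} ⊗ R_{q,k_q}^{−1}) a; that is, aᵀ (R_{p,k_p}^{−1} ⊗ R_{q,k_q}^{−1}) a = 0, where ⊗ denotes the Kronecker product and R^{−1} denotes the inverse (transpose) of the rotation matrix R. -/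
open Matrix Real Kronecker

theorem rot_inv (m : ℕ) (s : ℤ) : (rot m s)⁻¹ = (rot m s)ᵀ := by
  apply Matrix.inv_eq_right_inv
  ext i j
  fin_cases i <;> fin_cases j <;>
    simp [rot, Matrix.mul_apply, Fin.sum_univ_two] <;>
    linarith [Real.sin_sq_add_cos_sq (2 * Real.pi * s / m)]

theorem stmt4 (p q : ℕ) (hp : 3 ≤ p) (hq : 3 ≤ q) (hpodd : Odd p) (hqodd : Odd q)
    (hpq : Nat.Coprime p q) (kp kq : ℤ)
    (hkp : Int.gcd kp p = 1) (hkq : Int.gcd kq q = 1)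
    (c : ℝ) (hc : c ≠ 0)
    (hc2 : c ^ 2 = - Real.cos (2 * Real.pi * ((kp : ℝ) / p - (kq : ℝ) / q)) /
        Real.cos (2 * Real.pi * ((kp : ℝ) / p + (kq : ℝ) / q)))
    (a : Fin 2 × Fin 2 → ℝ)
    (ha : a = vec4 ((1 - c) * Real.cos (2 * Real.pi * kq / q))
        ((1 - c) * Real.sin (2 * Real.pi * kq / q))
        (-(1 + c) * Real.sin (2 * Real.pi * kq / q))
        ((1 + c) * Real.cos (2 * Real.pi * kq / q))) :
    a ⬝ᵥ (((rot p kp)⁻¹ ⊗ₖ (rot q kq)⁻¹) *ᵥ a) = 0 := by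
  have hcos : Real.cos (2 * Real.pi * ((kp : ℝ) / p + (kq : ℝ) / q)) ≠ 0 := by
    intro h
    rw [h, div_zero] at hc2
    exact hc (pow_eq_zero_iff two_ne_zero |>.mp hc2)
  rw [eq_div_iff hcos, mul_add, mul_sub, ← mul_div_assoc, ← mul_div_assoc,
    Real.cos_add, Real.cos_sub] at hc2
  rw [rot_inv, rot_inv, ha]
  simp only [dotProduct, mulVec, Fintype.sum_prod_type, Fin.sum_univ_two, vec4, rot,
    kroneckerMap_apply, transpose_apply, of_apply, cons_val_zero, cons_val_one]
  generalize Real.cos (2 * Real.pi * kp / p) = x at *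
  generalize Real.sin (2 * Real.pi * kp / p) = y at *
  generalize Real.cos (2 * Real.pi * kq / q) = u at *
  generalize Real.sin (2 * Real.pi * kq / q) = v at *
  linear_combination 2 * (v ^ 2 + u ^ 2) * hc2
end

section
/- The vector b is orthogonal to (R_{p,k_p}^{−1} ⊗ R_{q,k_q}) b; that is, bᵀ (R_{p,k_p}^{−1} ⊗ R_{q,k_q}) b = 0, where ⊗ denotes the Kronecker product and R^{−1} denotes the inverse (transpose) of the rotation matrix R. -/
open Matrix Real Kronecker

theorem stmt5 (p q : ℕ) (hp : 3 ≤ p) (hq : 3 ≤ q) (hpodd : Odd p) (hqodd : Odd q)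
    (hpq : Nat.Coprime p q) (kp kq : ℤ)
    (hkp : Int.gcd kp p = 1) (hkq : Int.gcd kq q = 1)
    (c : ℝ) (hc : c ≠ 0)
    (hc2 : c ^ 2 = - Real.cos (2 * Real.pi * ((kp : ℝ) / p - (kq : ℝ) / q)) /
        Real.cos (2 * Real.pi * ((kp : ℝ) / p + (kq : ℝ) / q)))
    (b : Fin 2 × Fin 2 → ℝ)
    (hb : b = vec4 (c + 1) 0 0 (c - 1)) :
    b ⬝ᵥ (((rot p kp)⁻¹ ⊗ₖ rot q kq) *ᵥ b) = 0 := by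
  have hden : Real.cos (2 * Real.pi * ((kp : ℝ) / p + (kq : ℝ) / q)) ≠ 0 := by
    intro h
    rw [h, div_zero] at hc2
    exact hc (pow_eq_zero_iff two_ne_zero |>.mp hc2)
  rw [eq_div_iff hden, mul_add, mul_sub, Real.cos_add, Real.cos_sub,
    ← mul_div_assoc, ← mul_div_assoc] at hc2
  subst hb
  rw [rot_inv]
  simp only [dotProduct, mulVec, Fintype.sum_prod_type, Fin.sum_univ_two, kroneckerMap_apply,
    transpose_apply, rot, vec4, of_apply, cons_val_zero, cons_val_one, cons_val', cons_val_fin_one]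
  linear_combination 2 * hc2
end

section
/- Let p, q ≥ 3 be odd integers, and for x ∈ {p, q} define k_x = ⌈x/4⌉ if x ≡ 3 (mod 4) and k_x = ⌊x/4⌋ if x ≡ 1 (mod 4). Then −cos(2π(k_p/p − k_q/q)) / cos(2π(k_p/p + k_q/q)) > 0; in particular there exists a nonzero real number c with c² = −cos(2π(k_p/p − k_q/q)) / cos(2π(k_p/p + k_q/q)). -/
open Real

/-- The integer nearest to `x / 4`, for `x` odd, satisfies `4 k = x ± 1`. -/
lemma abs_four_mul_sub_eq_one {x : ℕ} {k : ℤ} (hodd : Odd x)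
    (hk : (x % 4 = 3 → k = ⌈(x : ℚ) / 4⌉) ∧ (x % 4 = 1 → k = ⌊(x : ℚ) / 4⌋)) :
    |4 * k - x| = 1 := by
  have hfloor : ⌊(x : ℚ) / 4⌋ = (x : ℤ) / 4 := by
    simpa using Rat.floor_intCast_div_natCast (x : ℤ) 4
  have hceil : ⌈(x : ℚ) / 4⌉ = -(-(x : ℤ) / 4) := by
    simpa using Rat.ceil_intCast_div_natCast (x : ℤ) 4
  rw [hfloor, hceil] at hk
  obtain ⟨m, rfl⟩ := hodd
  obtain ⟨h₃, h₁⟩ := hk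
  have : 4 * k - (2 * m + 1 : ℕ) = 1 ∨ 4 * k - (2 * m + 1 : ℕ) = -1 := by omega
  rcases this with h | h <;> rw [h] <;> rfl

/-- If `4 k = x ± 1` and `x ≥ 3`, then `2π k / x` is within `π / 6` of `π / 2`. -/
lemma abs_two_pi_mul_div_sub_pi_div_two_le {x : ℕ} {k : ℤ} (hx : 3 ≤ x)
    (hk : |4 * k - x| = 1) : |2 * π * ((k : ℝ) / x) - π / 2| ≤ π / 6 := by
  have hx' : (3 : ℝ) ≤ x := by exact_mod_cast hx
  have hk' : |4 * (k : ℝ) - x| = 1 := by exact_mod_cast hk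
  have h : 2 * π * ((k : ℝ) / x) - π / 2 = (4 * k - x) * (π / (2 * x)) := by
    field_simp
    ring
  rw [h, abs_mul, hk', one_mul, abs_of_nonneg (by positivity)]
  exact div_le_div_of_nonneg_left pi_pos.le (by norm_num) (by linarith)

theorem stmt9 (p q : ℕ) (hp : 3 ≤ p) (hq : 3 ≤ q) (hpodd : Odd p) (hqodd : Odd q)
    (kp kq : ℤ)
    (hkp : (p % 4 = 3 → kp = ⌈(p : ℚ) / 4⌉) ∧ (p % 4 = 1 → kp = ⌊(p : ℚ) / 4⌋))
    (hkq : (q % 4 = 3 → kq = ⌈(q : ℚ) / 4⌉) ∧ (q % 4 = 1 → kq = ⌊(q : ℚ) / 4⌋)) :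
    0 < - Real.cos (2 * Real.pi * ((kp : ℝ) / p - (kq : ℝ) / q)) /
        Real.cos (2 * Real.pi * ((kp : ℝ) / p + (kq : ℝ) / q)) ∧
    ∃ c : ℝ, c ≠ 0 ∧
      c ^ 2 = - Real.cos (2 * Real.pi * ((kp : ℝ) / p - (kq : ℝ) / q)) /
        Real.cos (2 * Real.pi * ((kp : ℝ) / p + (kq : ℝ) / q)) := by
  have hpos : 0 < -cos (2 * π * ((kp : ℝ) / p - (kq : ℝ) / q)) /
      cos (2 * π * ((kp : ℝ) / p + (kq : ℝ) / q)) := by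
    obtain ⟨hp₁, hp₂⟩ := abs_le.mp <|
      abs_two_pi_mul_div_sub_pi_div_two_le hp (abs_four_mul_sub_eq_one hpodd hkp)
    obtain ⟨hq₁, hq₂⟩ := abs_le.mp <|
      abs_two_pi_mul_div_sub_pi_div_two_le hq (abs_four_mul_sub_eq_one hqodd hkq)
    have hπ := pi_pos
    rw [mul_sub, mul_add]
    refine div_pos_of_neg_of_neg (neg_neg_of_pos (cos_pos_of_mem_Ioo ⟨?_, ?_⟩))
      (cos_neg_of_pi_div_two_lt_of_lt ?_ ?_) <;> linarith
  exact ⟨hpos, √_, (sqrt_pos.mpr hpos).ne', sq_sqrt hpos.le⟩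
end

section
/- The 2pq vectors M^i a (0 ≤ i < pq) and M^i b (0 ≤ i < pq) are pairwise linearly independent over ℝ; that is, for 0 ≤ i < j < pq the vectors M^i a and M^j a are linearly independent, the vectors M^i b and M^j b are linearly independent, and for all 0 ≤ i, j < pq the vectors M^i a and M^j b are linearly independent. -/
open Matrix Real Kronecker

/-- The rotation component of a `2 × 2` real matrix, acting on `ℂ = ℝ²` as
`z ↦ (α z + β conj z) / 2`: the coefficient `α`. -/
noncomputable def rotationPart : (Fin 2 × Fin 2 → ℝ) →ₗ[ℝ] ℂ where
  toFun v := ⟨v (0, 0) + v (1, 1), v (1, 0) - v (0, 1)⟩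
  map_add' u v := by apply Complex.ext <;> simp <;> ring
  map_smul' r v := by apply Complex.ext <;> simp <;> ring

/-- The reflection component of a `2 × 2` real matrix, acting on `ℂ = ℝ²` as
`z ↦ (α z + β conj z) / 2`: the coefficient `β`. -/
noncomputable def reflectionPart : (Fin 2 × Fin 2 → ℝ) →ₗ[ℝ] ℂ where
  toFun v := ⟨v (0, 0) - v (1, 1), v (1, 0) + v (0, 1)⟩
  map_add' u v := by apply Complex.ext <;> simp <;> ring
  map_smul' r v := by apply Complex.ext <;> simp <;> ring

lemma rotationPart_rot_mulVec (p q : ℕ) (k l : ℤ) (v : Fin 2 × Fin 2 → ℝ) :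
    rotationPart ((rot p k ⊗ₖ rot q l) *ᵥ v) =
      Complex.exp (((2 * π * k / p - 2 * π * l / q : ℝ) : ℂ) * Complex.I) * rotationPart v := by
  apply Complex.ext <;>
    simp only [rotationPart, rot, LinearMap.coe_mk, AddHom.coe_mk, Matrix.mulVec, dotProduct,
      Fintype.sum_prod_type, Fin.sum_univ_two, Matrix.kroneckerMap_apply, Complex.mul_re,
      Complex.mul_im, Complex.exp_ofReal_mul_I_re, Complex.exp_ofReal_mul_I_im, Real.cos_sub,
      Real.sin_sub, Matrix.of_apply, Matrix.cons_val', Matrix.cons_val_zero, Matrix.cons_val_one,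
      Matrix.cons_val_fin_one] <;>
    ring

lemma reflectionPart_rot_mulVec (p q : ℕ) (k l : ℤ) (v : Fin 2 × Fin 2 → ℝ) :
    reflectionPart ((rot p k ⊗ₖ rot q l) *ᵥ v) =
      Complex.exp (((2 * π * k / p + 2 * π * l / q : ℝ) : ℂ) * Complex.I) * reflectionPart v := by
  apply Complex.ext <;>
    simp only [reflectionPart, rot, LinearMap.coe_mk, AddHom.coe_mk, Matrix.mulVec, dotProduct,
      Fintype.sum_prod_type, Fin.sum_univ_two, Matrix.kroneckerMap_apply, Complex.mul_re,
      Complex.mul_im, Complex.exp_ofReal_mul_I_re, Complex.exp_ofReal_mul_I_im, Real.cos_add,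
      Real.sin_add, Matrix.of_apply, Matrix.cons_val', Matrix.cons_val_zero, Matrix.cons_val_one,
      Matrix.cons_val_fin_one] <;>
    ring

lemma map_pow_mulVec {ι : Type*} [Fintype ι] [DecidableEq ι] (M : Matrix ι ι ℝ)
    (f : (ι → ℝ) →ₗ[ℝ] ℂ) (w : ℂ) (h : ∀ v, f (M *ᵥ v) = w * f v) (n : ℕ) (v : ι → ℝ) :
    f ((M ^ n) *ᵥ v) = w ^ n * f v := by
  induction n with
  | zero => simp
  | succ n ih => rw [pow_succ', ← Matrix.mulVec_mulVec, h, ih, pow_succ']; ring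

lemma dvd_of_exp_eq_one {m n : ℕ} {k : ℤ} (hm : Odd m) (hk : Int.gcd k m = 1)
    (h : Complex.exp (((2 * π * k / m : ℝ) : ℂ) * Complex.I) ^ (2 * n) = 1) : m ∣ n := by
  have hm0 : (m : ℂ) ≠ 0 := by exact_mod_cast hm.pos.ne'
  rw [← Complex.exp_nat_mul, Complex.exp_eq_one_iff] at h
  obtain ⟨l, hl⟩ := h
  have hpi : (π : ℂ) ≠ 0 := by exact_mod_cast Real.pi_ne_zero
  have hI := Complex.I_ne_zero
  push_cast at hl
  field_simp at hl
  have hz : k * (2 * n) = m * l := by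
    have : (k : ℂ) * (2 * n) = m * l := by linear_combination hl
    exact_mod_cast this
  have hdvd : (m : ℤ) ∣ 2 * n :=
    Int.dvd_of_dvd_mul_right_of_gcd_one ⟨l, hz⟩ (by rwa [Int.gcd_comm])
  have hdvd' : m ∣ 2 * n := by exact_mod_cast hdvd
  exact (Nat.Coprime.dvd_of_dvd_mul_left (Nat.coprime_two_right.mpr hm) hdvd')

lemma cos_two_pi_mul_div_ne_zero_s10 {m : ℕ} (hm : Odd m) (k : ℤ) : cos (2 * π * k / m) ≠ 0 := by
  have hm0 : (m : ℝ) ≠ 0 := by exact_mod_cast hm.pos.ne'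
  rw [Real.cos_ne_zero_iff]
  intro l hl
  field_simp at hl
  have hz : 4 * k = (2 * l + 1) * m := by
    have : (4 : ℝ) * k = (2 * l + 1) * m := by linear_combination hl
    exact_mod_cast this
  have hodd : Odd ((2 * l + 1) * (m : ℤ)) := (odd_two_mul_add_one l).mul (by exact_mod_cast hm)
  rw [← hz] at hodd
  exact Int.not_odd_iff_even.mpr ⟨2 * k, by ring⟩ hodd

lemma sq_eq_sq_of_smul_add_smul_eq_zero {s t : ℝ} {w α β : ℂ} (hw : ‖w‖ = 1) {i j : ℕ}
    (h : s • (w ^ i * α) + t • (w ^ j * β) = 0) : s ^ 2 * ‖α‖ ^ 2 = t ^ 2 * ‖β‖ ^ 2 := by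
  have := congrArg (fun x => ‖x‖ ^ 2) (eq_neg_of_add_eq_zero_left h)
  simpa [norm_smul, hw, mul_pow] using this

/-- If two linear coordinates scale by unit complex numbers `e^{i(x-y)}` and `e^{i(x+y)}` under
`M`, vectors in the same `M`-orbit are independent unless `e^{2inx} = e^{2iny} = 1`. -/
lemma linearIndependent_pow_mulVec {ι : Type*} [Fintype ι] [DecidableEq ι] {M : Matrix ι ι ℝ}
    {f g : (ι → ℝ) →ₗ[ℝ] ℂ} {x y : ℝ}
    (hf : ∀ v, f (M *ᵥ v) = Complex.exp (((x - y : ℝ) : ℂ) * Complex.I) * f v)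
    (hg : ∀ v, g (M *ᵥ v) = Complex.exp (((x + y : ℝ) : ℂ) * Complex.I) * g v)
    {v : ι → ℝ} (hfv : f v ≠ 0) (hgv : g v ≠ 0) {i j : ℕ} (hij : i ≤ j)
    (hxy : ¬ (Complex.exp ((x : ℂ) * Complex.I) ^ (2 * (j - i)) = 1 ∧
      Complex.exp ((y : ℂ) * Complex.I) ^ (2 * (j - i)) = 1)) :
    LinearIndependent ℝ ![(M ^ i) *ᵥ v, (M ^ j) *ᵥ v] := by
  obtain ⟨n, rfl⟩ := Nat.exists_eq_add_of_le hij
  rw [Nat.add_sub_cancel_left] at hxy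
  rw [LinearIndependent.pair_iff]
  intro s t hst
  have h1 := congrArg f hst
  have h2 := congrArg g hst
  simp only [map_add, map_smul, map_zero, map_pow_mulVec M f _ hf, map_pow_mulVec M g _ hg]
    at h1 h2
  have hsq := sq_eq_sq_of_smul_add_smul_eq_zero (Complex.norm_exp_ofReal_mul_I _) h1
  have hsq : s ^ 2 = t ^ 2 := mul_right_cancel₀ (by simpa using hfv) hsq
  by_cases ht : t = 0
  · subst ht
    exact ⟨by simpa using hsq, rfl⟩
  exfalso
  apply hxy
  have key : ∀ {w α : ℂ}, w ≠ 0 → α ≠ 0 →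
      s • (w ^ i * α) + t • (w ^ (i + n) * α) = 0 → w ^ n = ((-s / t : ℝ) : ℂ) := by
    intro w α hw hα h
    have ht' : (t : ℂ) ≠ 0 := by exact_mod_cast ht
    rw [Complex.real_smul, Complex.real_smul] at h
    push_cast
    rw [eq_div_iff ht']
    apply mul_right_cancel₀ (mul_ne_zero (pow_ne_zero i hw) hα)
    linear_combination h
  have k1 := key (Complex.exp_ne_zero _) hfv h1
  have k2 := key (Complex.exp_ne_zero _) hgv h2
  have hr : (((-s / t : ℝ) : ℂ)) ^ 2 = 1 := by
    have : (-s / t) ^ 2 = 1 := by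
      rw [div_pow, neg_sq, hsq, div_self (pow_ne_zero 2 ht)]
    exact_mod_cast this
  have hr0 : ((-s / t : ℝ) : ℂ) ≠ 0 := by
    intro h0
    simp [h0] at hr
  have hx : Complex.exp (x * Complex.I) ^ 2 = Complex.exp (((x - y : ℝ) : ℂ) * Complex.I) *
      Complex.exp (((x + y : ℝ) : ℂ) * Complex.I) := by
    rw [← Complex.exp_add, ← Complex.exp_nat_mul]
    congr 1
    push_cast
    ring
  have hy : Complex.exp (((x - y : ℝ) : ℂ) * Complex.I) * Complex.exp (y * Complex.I) ^ 2 =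
      Complex.exp (((x + y : ℝ) : ℂ) * Complex.I) := by
    rw [← Complex.exp_nat_mul, ← Complex.exp_add]
    congr 1
    push_cast
    ring
  constructor
  · rw [pow_mul, hx, mul_pow, k1, k2, ← sq, hr]
  · have := congrArg (· ^ n) hy
    simp only [mul_pow, k1, k2, ← pow_mul] at this
    exact mul_left_cancel₀ hr0 (this.trans (mul_one _).symm)

theorem stmt10 (p q : ℕ) (hp : 3 ≤ p) (hq : 3 ≤ q) (hpodd : Odd p) (hqodd : Odd q)
    (hpq : Nat.Coprime p q) (kp kq : ℤ)
    (hkp : Int.gcd kp p = 1) (hkq : Int.gcd kq q = 1)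
    (c : ℝ) (hc : c ≠ 0)
    (hc2 : c ^ 2 = - Real.cos (2 * Real.pi * ((kp : ℝ) / p - (kq : ℝ) / q)) /
        Real.cos (2 * Real.pi * ((kp : ℝ) / p + (kq : ℝ) / q)))
    (a b : Fin 2 × Fin 2 → ℝ)
    (ha : a = vec4 ((1 - c) * Real.cos (2 * Real.pi * kq / q))
        ((1 - c) * Real.sin (2 * Real.pi * kq / q))
        (-(1 + c) * Real.sin (2 * Real.pi * kq / q))
        ((1 + c) * Real.cos (2 * Real.pi * kq / q)))
    (hb : b = vec4 (c + 1) 0 0 (c - 1))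
    (M : Matrix (Fin 2 × Fin 2) (Fin 2 × Fin 2) ℝ)
    (hM : M = rot p kp ⊗ₖ rot q kq) :
    (∀ i j : ℕ, i < j → j < p * q →
      LinearIndependent ℝ ![(M ^ i) *ᵥ a, (M ^ j) *ᵥ a]) ∧
    (∀ i j : ℕ, i < j → j < p * q →
      LinearIndependent ℝ ![(M ^ i) *ᵥ b, (M ^ j) *ᵥ b]) ∧
    (∀ i j : ℕ, i < p * q → j < p * q →
      LinearIndependent ℝ ![(M ^ i) *ᵥ a, (M ^ j) *ᵥ b]) := by
  subst hM
  set x : ℝ := 2 * π * kp / p with hx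
  set y : ℝ := 2 * π * kq / q with hy
  have hf := rotationPart_rot_mulVec p q kp kq
  have hg := reflectionPart_rot_mulVec p q kp kq
  rw [← hx, ← hy] at hf hg
  have hu := Complex.norm_exp_ofReal_mul_I
  have hfa : rotationPart a = 2 * Complex.exp (((-y : ℝ) : ℂ) * Complex.I) := by
    subst ha
    apply Complex.ext <;>
      simp only [Complex.mul_re, Complex.mul_im, Complex.exp_ofReal_mul_I_re,
        Complex.exp_ofReal_mul_I_im] <;>
      simp [rotationPart, vec4] <;> ring
  have hga : reflectionPart a = ((-2 * c : ℝ) : ℂ) * Complex.exp ((y : ℂ) * Complex.I) := by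
    subst ha
    apply Complex.ext <;>
      simp only [Complex.mul_re, Complex.mul_im, Complex.exp_ofReal_mul_I_re,
        Complex.exp_ofReal_mul_I_im, Complex.ofReal_re, Complex.ofReal_im] <;>
      simp [reflectionPart, vec4] <;> ring
  have hfb : rotationPart b = ((2 * c : ℝ) : ℂ) := by
    subst hb
    apply Complex.ext <;> simp only [Complex.ofReal_re, Complex.ofReal_im] <;>
      simp [rotationPart, vec4] <;> ring
  have hgb : reflectionPart b = 2 := by
    subst hb
    apply Complex.ext <;> simp [reflectionPart, vec4] <;> ring
  have hfa0 : rotationPart a ≠ 0 := by simp [hfa]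
  have hga0 : reflectionPart a ≠ 0 := by simp [hga, hc]
  have hfb0 : rotationPart b ≠ 0 := by simp [hfb, hc]
  have hgb0 : reflectionPart b ≠ 0 := by simp [hgb]
  have hperiod : ∀ i j : ℕ, i < j → j < p * q →
      ¬ (Complex.exp ((x : ℂ) * Complex.I) ^ (2 * (j - i)) = 1 ∧
        Complex.exp ((y : ℂ) * Complex.I) ^ (2 * (j - i)) = 1) := by
    rintro i j hij hj ⟨h1, h2⟩
    have hdvd := hpq.mul_dvd_of_dvd_of_dvd (dvd_of_exp_eq_one hpodd hkp h1)
      (dvd_of_exp_eq_one hqodd hkq h2)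
    have := Nat.le_of_dvd (by lia) hdvd
    lia
  refine ⟨fun i j hij hj => linearIndependent_pow_mulVec hf hg hfa0 hga0 hij.le
      (hperiod i j hij hj),
    fun i j hij hj => linearIndependent_pow_mulVec hf hg hfb0 hgb0 hij.le (hperiod i j hij hj),
    fun i j _ _ => ?_⟩
  have hc1 : c ^ 2 ≠ 1 := by
    intro h1
    have e1 : 2 * π * ((kp : ℝ) / p - kq / q) = x - y := by rw [hx, hy]; ring
    have e2 : 2 * π * ((kp : ℝ) / p + kq / q) = x + y := by rw [hx, hy]; ring
    rw [h1, e1, e2] at hc2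
    have hne : cos (x + y) ≠ 0 := by
      intro h0
      simp [h0] at hc2
    rw [eq_div_iff hne, Real.cos_add, Real.cos_sub] at hc2
    exact mul_ne_zero (cos_two_pi_mul_div_ne_zero_s10 hpodd kp) (cos_two_pi_mul_div_ne_zero_s10 hqodd kq)
      (by linear_combination hc2 / 2)
  rw [LinearIndependent.pair_iff]
  intro s t hst
  have h1 := congrArg rotationPart hst
  have h2 := congrArg reflectionPart hst
  simp only [map_add, map_smul, map_zero, map_pow_mulVec _ _ _ hf, map_pow_mulVec _ _ _ hg]
    at h1 h2
  have n1 := sq_eq_sq_of_smul_add_smul_eq_zero (hu _) h1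
  have n2 := sq_eq_sq_of_smul_add_smul_eq_zero (hu _) h2
  simp only [hfa, hfb, hga, hgb, norm_mul, hu, Complex.norm_real, Real.norm_eq_abs, mul_pow,
    sq_abs, Complex.norm_ofNat] at n1 n2
  have hsum : (c ^ 2 + 1) * (1 - c ^ 2) ≠ 0 :=
    mul_ne_zero (by positivity) (sub_ne_zero.mpr (Ne.symm hc1))
  have hs : s ^ 2 = 0 := by
    apply mul_right_cancel₀ hsum
    linear_combination n1 / 4 - c ^ 2 * n2 / 4
  have ht : t ^ 2 = 0 := by
    apply mul_right_cancel₀ hsum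
    linear_combination c ^ 2 * n1 / 4 - n2 / 4
  exact ⟨pow_eq_zero_iff two_ne_zero |>.mp hs, pow_eq_zero_iff two_ne_zero |>.mp ht⟩
end

section
/- For every integer i with 0 < i < pq, the matrix M^i has no real eigenvector: there is no nonzero vector v ∈ ℝ⁴ and real number λ with M^i v = λ v. Consequently, for 0 ≤ i < j < pq, M^i a and M^j a are linearly independent for every nonzero a ∈ ℝ⁴, and likewise for M^i b and M^j b. -/
open Matrix Real Kronecker

theorem rot_mul_rot (m : ℕ) (s t : ℤ) : rot m s * rot m t = rot m (s + t) := by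
  have h : 2 * π * ((s + t : ℤ) : ℝ) / m = 2 * π * s / m + 2 * π * t / m := by
    push_cast; ring
  simp only [rot, h, Real.cos_add, Real.sin_add]
  ext i j
  fin_cases i <;> fin_cases j <;> simp [Matrix.mul_apply, Fin.sum_univ_two] <;> ring

theorem rot_kronecker_rot_pow (p q : ℕ) (s t : ℤ) (n : ℕ) :
    (rot p s ⊗ₖ rot q t) ^ n = rot p (n * s) ⊗ₖ rot q (n * t) := by
  induction n with
  | zero => simp [rot_zero]
  | succ n ih =>
    rw [pow_succ, ih, ← Matrix.mul_kronecker_mul, rot_mul_rot, rot_mul_rot]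
    push_cast
    simp only [add_mul, one_mul]

/-- A planar rotation by an angle `ψ` with `sin ψ ≠ 0` has no real eigenvector. -/
theorem eq_zero_of_rotation_eigenvector {ψ x y l : ℝ} (h : Real.sin ψ ≠ 0)
    (hx : Real.cos ψ * x - Real.sin ψ * y = l * x)
    (hy : Real.sin ψ * x + Real.cos ψ * y = l * y) : x = 0 ∧ y = 0 := by
  have h1 : Real.sin ψ * (x ^ 2 + y ^ 2) = 0 := by linear_combination x * hy - y * hx
  have h2 : x ^ 2 + y ^ 2 = 0 := (mul_eq_zero.mp h1).resolve_left h
  constructor <;> nlinarith [sq_nonneg x, sq_nonneg y]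

theorem eq_zero_of_rot_kronecker_rot_mulVec {p q : ℕ} {s t : ℤ}
    (hadd : Real.sin (2 * π * s / p + 2 * π * t / q) ≠ 0)
    (hsub : Real.sin (2 * π * s / p - 2 * π * t / q) ≠ 0)
    {v : Fin 2 × Fin 2 → ℝ} {l : ℝ} (hv : (rot p s ⊗ₖ rot q t) *ᵥ v = l • v) : v = 0 := by
  have h00 := congrFun hv (0, 0)
  have h01 := congrFun hv (0, 1)
  have h10 := congrFun hv (1, 0)
  have h11 := congrFun hv (1, 1)
  simp only [Matrix.mulVec, dotProduct, Fintype.sum_prod_type, Fin.sum_univ_two,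
    Matrix.kroneckerMap_apply, rot, Matrix.of_apply, Matrix.cons_val', Matrix.cons_val_zero,
    Matrix.cons_val_one, Matrix.cons_val_fin_one, Pi.smul_apply, smul_eq_mul]
    at h00 h01 h10 h11
  obtain ⟨h1, h2⟩ := eq_zero_of_rotation_eigenvector (l := l)
    (x := v (0, 0) - v (1, 1)) (y := v (0, 1) + v (1, 0)) hadd
    (by rw [Real.cos_add, Real.sin_add]; linear_combination h00 - h11)
    (by rw [Real.cos_add, Real.sin_add]; linear_combination h01 + h10)
  obtain ⟨h3, h4⟩ := eq_zero_of_rotation_eigenvector (l := l)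
    (x := v (0, 0) + v (1, 1)) (y := v (1, 0) - v (0, 1)) hsub
    (by rw [Real.cos_sub, Real.sin_sub]; linear_combination h00 + h11)
    (by rw [Real.cos_sub, Real.sin_sub]; linear_combination h10 - h01)
  ext ⟨i, j⟩
  fin_cases i <;> fin_cases j <;> simp <;> linarith

theorem dvd_of_sin_eq_zero {p q : ℕ} (hpodd : Odd p) (hqodd : Odd q) (hpq : Nat.Coprime p q)
    {s t : ℤ} (hs : Int.gcd s p = 1) (ht : Int.gcd t q = 1) {n : ℕ}
    (h : Real.sin (2 * π * (n * s : ℤ) / p + 2 * π * (n * t : ℤ) / q) = 0) : p * q ∣ n := by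
  obtain ⟨k, hk⟩ := Real.sin_eq_zero_iff.mp h
  have hp0 : (p : ℝ) ≠ 0 := by exact_mod_cast hpodd.pos.ne'
  have hq0 : (q : ℝ) ≠ 0 := by exact_mod_cast hqodd.pos.ne'
  have hk' : k * (p * q) = 2 * (s * q + t * p) * n := by
    field_simp at hk
    push_cast at hk
    have : (k : ℝ) * (p * q) = 2 * (s * q + t * p) * n := by linear_combination hk
    exact_mod_cast this
  have hpq' : IsCoprime (p : ℤ) q := Nat.isCoprime_iff_coprime.mpr hpq
  have hp2 : IsCoprime (p : ℤ) 2 :=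
    Nat.isCoprime_iff_coprime.mpr (Nat.coprime_two_right.mpr hpodd)
  have hq2 : IsCoprime (q : ℤ) 2 :=
    Nat.isCoprime_iff_coprime.mpr (Nat.coprime_two_right.mpr hqodd)
  have hps : IsCoprime (p : ℤ) s := (Int.isCoprime_iff_gcd_eq_one.mpr hs).symm
  have hqt : IsCoprime (q : ℤ) t := (Int.isCoprime_iff_gcd_eq_one.mpr ht).symm
  have hpn : (p : ℤ) ∣ n :=
    (hp2.mul_right ((hps.mul_right hpq').add_mul_right_right t)).dvd_of_dvd_mul_left
      ⟨k * q, by linear_combination -hk'⟩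
  have hqn : (q : ℤ) ∣ n :=
    (hq2.mul_right ((hqt.mul_right hpq'.symm).mul_add_right_right s)).dvd_of_dvd_mul_left
      ⟨k * p, by linear_combination -hk'⟩
  exact hpq.mul_dvd_of_dvd_of_dvd (Int.natCast_dvd_natCast.mp hpn) (Int.natCast_dvd_natCast.mp hqn)

/-- If `B` is invertible and `a` is not an eigenvector of `A`, then `B a` and `B A a` are linearly
independent. -/
theorem linearIndependent_mulVec_pair {ι : Type*} [Fintype ι] [DecidableEq ι]
    {A B : Matrix ι ι ℝ} (hB : IsUnit B) {a : ι → ℝ} (ha : a ≠ 0)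
    (hA : ∀ l : ℝ, A *ᵥ a ≠ l • a) : LinearIndependent ℝ ![B *ᵥ a, (B * A) *ᵥ a] := by
  have hind : LinearIndependent ℝ ![a, A *ᵥ a] :=
    (LinearIndependent.pair_iff' ha).mpr fun l hl => hA l hl.symm
  have h := hind.map' B.mulVecLin
    (LinearMap.ker_eq_bot.mpr (Matrix.mulVec_injective_iff_isUnit.mpr hB))
  have hcomp : ⇑B.mulVecLin ∘ ![a, A *ᵥ a] = ![B *ᵥ a, (B * A) *ᵥ a] := by
    ext i : 1
    fin_cases i <;> simp [Matrix.mulVec_mulVec]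
  rwa [hcomp] at h

theorem stmt11 (p q : ℕ) (hp : 3 ≤ p) (hq : 3 ≤ q) (hpodd : Odd p) (hqodd : Odd q)
    (hpq : Nat.Coprime p q) (kp kq : ℤ)
    (hkp : Int.gcd kp p = 1) (hkq : Int.gcd kq q = 1)
    (M : Matrix (Fin 2 × Fin 2) (Fin 2 × Fin 2) ℝ)
    (hM : M = rot p kp ⊗ₖ rot q kq) :
    (∀ i : ℕ, 0 < i → i < p * q →
      ¬ ∃ (v : Fin 2 × Fin 2 → ℝ) (lam : ℝ), v ≠ 0 ∧ (M ^ i) *ᵥ v = lam • v) ∧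
    (∀ a : Fin 2 × Fin 2 → ℝ, a ≠ 0 → ∀ i j : ℕ, i < j → j < p * q →
      LinearIndependent ℝ ![(M ^ i) *ᵥ a, (M ^ j) *ᵥ a]) := by
  have hdvd (i : ℕ) (hi : 0 < i) (hi' : i < p * q) : ¬ p * q ∣ i := Nat.not_dvd_of_pos_of_lt hi hi'
  have heig (i : ℕ) (hi : 0 < i) (hi' : i < p * q) (v : Fin 2 × Fin 2 → ℝ) (l : ℝ)
      (hv : (M ^ i) *ᵥ v = l • v) : v = 0 := by
    rw [hM, rot_kronecker_rot_pow] at hv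
    refine eq_zero_of_rot_kronecker_rot_mulVec
      (fun h => hdvd i hi hi' (dvd_of_sin_eq_zero hpodd hqodd hpq hkp hkq h))
      (fun h => hdvd i hi hi' (dvd_of_sin_eq_zero (t := -kq) hpodd hqodd hpq hkp
        (by rwa [Int.neg_gcd]) ?_)) hv
    rw [← h]
    congr 1
    push_cast
    ring
  have hunit : IsUnit M := by
    refine IsUnit.of_mul_eq_one (rot p (-kp) ⊗ₖ rot q (-kq)) ?_
    rw [hM, ← Matrix.mul_kronecker_mul, rot_mul_rot, rot_mul_rot]
    simp [rot_zero]
  refine ⟨fun i hi hi' ⟨v, l, hv, h⟩ => hv (heig i hi hi' v l h), fun a ha i j hij hj => ?_⟩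
  rw [← Nat.add_sub_of_le hij.le, pow_add]
  exact linearIndependent_mulVec_pair (hunit.pow i) ha fun l hl =>
    ha (heig (j - i) (Nat.sub_pos_of_lt hij) ((Nat.sub_le j i).trans_lt hj) a l hl)
end
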